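/- Let F be a forest on a finite vertex set V with |V| = n ≥ 1. Define S_0 = V and S_{k+1} = { v ∈ S_k : the degree of v in the subgraph of F induced on S_k is at least 3 }. Then S_k = ∅ for every k with (2/3)^k · n < 1; in particular the peeling process terminates after at most ⌈log_{3/2} n⌉ + 1 iterations. -/

import Mathlib

theorem forest_edges_le {W : Type*} [Fintype W] [Nonempty W]
    (G : SimpleGraph W) [Fintype G.edgeSet] (hG : G.IsAcyclic) :
    G.edgeFinset.card ≤ Fintype.card W := by
  classical
  obtain ⟨T, hle, -, hT⟩ :=
    (SimpleGraph.connected_top (V := W)).exists_isTree_le_of_le_of_isAcyclic le_top hG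
  have h1 := hT.card_edgeFinset
  have h2 : G.edgeFinset.card ≤ T.edgeFinset.card := Finset.card_mono (by simpa using hle)
  omega

theorem forest_sum_deg {V : Type*} [Fintype V] [DecidableEq V]
    (F : SimpleGraph V) [DecidableRel F.Adj] (hF : F.IsAcyclic) (S : Finset V) :
    ∑ v ∈ S, (S.filter fun u => F.Adj v u).card ≤ 2 * S.card := by
  rcases S.eq_empty_or_nonempty with rfl | hne
  · simp
  have : Nonempty S := hne.to_subtype
  let G : SimpleGraph S := F.comap (Function.Embedding.subtype (· ∈ S))
  have hG : G.IsAcyclic := hF.of_comap _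
  classical
  have h1 := forest_edges_le G hG
  have h2 := G.sum_degrees_eq_twice_card_edges
  rw [← Finset.sum_coe_sort]
  have h3 : ∀ v : S, (S.filter fun u => F.Adj v u).card = G.degree v := by
    intro v
    rw [← SimpleGraph.card_neighborFinset_eq_degree,
      ← Finset.card_map (Function.Embedding.subtype (· ∈ S))]
    congr 1
    ext u
    rw [Finset.mem_filter, Finset.mem_map]
    constructor
    · rintro ⟨hu, ha⟩
      exact ⟨⟨u, hu⟩, (SimpleGraph.mem_neighborFinset _ _ _).mpr ha, rfl⟩
    · rintro ⟨w, hw, rfl⟩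
      exact ⟨w.2, (SimpleGraph.mem_neighborFinset G v w).mp hw⟩
  simp only [h3]
  rw [Fintype.card_coe] at h1
  omega

theorem peel_step {V : Type*} [Fintype V] [DecidableEq V]
    (F : SimpleGraph V) [DecidableRel F.Adj] (hF : F.IsAcyclic) (S : Finset V) :
    3 * (S.filter fun v => 3 ≤ (S.filter fun u => F.Adj v u).card).card ≤ 2 * S.card := by
  refine le_trans ?_ (forest_sum_deg F hF S)
  rw [mul_comm, ← smul_eq_mul]
  refine le_trans (Finset.card_nsmul_le_sum _
    (fun v => (S.filter fun u => F.Adj v u).card) 3 (by simp)) ?_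
  exact Finset.sum_le_sum_of_subset (Finset.filter_subset _ _)

/-- For a forest `F` on `n ≥ 1` vertices, the iterated peeling
process `S_0 = V`, `S_{k+1} = {v ∈ S_k : deg_{S_k}(v) ≥ 3}` satisfies
`S_k = ∅` whenever `(2/3)^k · n < 1`; in particular the process terminates
after at most `⌈log_{3/2} n⌉ + 1` iterations. -/
theorem peeling_terminates {V : Type*} [Fintype V] [DecidableEq V]
    (F : SimpleGraph V) [DecidableRel F.Adj] (hF : F.IsAcyclic)
    (hn : 1 ≤ Fintype.card V)
    (S : ℕ → Finset V)
    (hS0 : S 0 = Finset.univ)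
    (hSsucc : ∀ k, S (k + 1) =
      (S k).filter fun v => 3 ≤ ((S k).filter fun u => F.Adj v u).card) :
    (∀ k : ℕ, (2 / 3 : ℚ) ^ k * Fintype.card V < 1 → S k = ∅) ∧
      S (⌈Real.logb (3 / 2) (Fintype.card V)⌉₊ + 1) = ∅ := by
  have hb : ∀ k, ((S k).card : ℚ) ≤ (2 / 3 : ℚ) ^ k * Fintype.card V := by
    intro k
    induction k with
    | zero => simp [hS0, Finset.card_univ]
    | succ k ih =>
      have h := peel_step F hF (S k)
      rw [← hSsucc k] at h
      have h' : (3 : ℚ) * (S (k + 1)).card ≤ 2 * (S k).card := by exact_mod_cast h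
      rw [pow_succ]
      linarith
  have main : ∀ k : ℕ, (2 / 3 : ℚ) ^ k * Fintype.card V < 1 → S k = ∅ := by
    intro k hk
    have h : ((S k).card : ℚ) < 1 := (hb k).trans_lt hk
    have h' : (S k).card < 1 := by exact_mod_cast h
    exact Finset.card_eq_zero.mp (by omega)
  refine ⟨main, main _ ?_⟩
  set m := ⌈Real.logb (3 / 2) (Fintype.card V)⌉₊ with hm
  have hpos : (0 : ℝ) < Fintype.card V := by exact_mod_cast hn
  have h1 : Real.logb (3 / 2) (Fintype.card V) ≤ (m : ℝ) := Nat.le_ceil _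
  rw [Real.logb_le_iff_le_rpow (by norm_num) hpos, Real.rpow_natCast] at h1
  have h2 : ((Fintype.card V : ℕ) : ℚ) ≤ (3 / 2 : ℚ) ^ m := by
    have h : (((Fintype.card V : ℕ) : ℚ) : ℝ) ≤ (((3 / 2 : ℚ) ^ m : ℚ) : ℝ) := by
      push_cast
      exact h1
    exact Rat.cast_le.mp h
  have h3 : (2 / 3 : ℚ) ^ m * (3 / 2 : ℚ) ^ m = 1 := by
    rw [← mul_pow]; norm_num
  have h4 : (2 / 3 : ℚ) ^ m * Fintype.card V ≤ 1 := by
    rw [← h3]; gcongr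
  rw [pow_succ]
  linarith
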